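/- arXiv:1301.0056 — 2 statements merged into one kernel-verified Lean document; each statement's English description precedes it below -/
import Mathlib

section
/- Let $q$ be a prime, let $N, a, m$ be natural numbers with $m \geq 1$, and assume that $q - 1$ does not divide $m$. Then there exists a prime $p > N$ such that $q$ does not divide $p^a (p^m - 1)$. -/
/-- Let `q` be a prime and `N a m` natural numbers with `m ≥ 1` such that `q - 1`
does not divide `m`.  Then there exists a prime `p > N` such that `q` does not
divide `p ^ a * (p ^ m - 1)`. -/
theorem exists_prime_not_dvd_pow_mul_pow_sub_one (q : ℕ) (hq : q.Prime)
    (N a m : ℕ) (hm : 1 ≤ m) (hnd : ¬ (q - 1) ∣ m) :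
    ∃ p : ℕ, p.Prime ∧ p > N ∧ ¬ (q : ℤ) ∣ (p : ℤ) ^ a * ((p : ℤ) ^ m - 1) := by
  have : Fact q.Prime := ⟨hq⟩
  obtain ⟨u, hu⟩ : ∃ u : (ZMod q)ˣ, u ^ m ≠ 1 := by
    by_contra! h
    exact hnd (by simpa using (FiniteField.forall_pow_eq_one_iff (ZMod q) m).1 h)
  obtain ⟨p, hpN, hp, hpu⟩ := Nat.forall_exists_prime_gt_and_eq_mod u.isUnit N
  refine ⟨p, hp, hpN, fun h ↦ ?_⟩
  rw [← ZMod.intCast_zmod_eq_zero_iff_dvd] at h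
  push_cast at h
  rw [hpu, ← Units.val_pow_eq_pow_val, Units.mul_right_eq_zero, sub_eq_zero] at h
  exact hu (Units.ext (by simpa using h))
end

section
/- Let $q$ be a prime, $\mathbb{Z}_{(q)}$ the localization of $\mathbb{Z}$ at the prime ideal $(q)$, and let $M, N$ be $\mathbb{Z}_{(q)}$-modules with a $\mathbb{Z}_{(q)}$-linear map $d : M \to N$. Let $p$ be a prime distinct from $q$ whose residue class generates $(\mathbb{Z}/q\mathbb{Z})^\times$, and let $j, r$ be integers with $r \geq 2$ and $j \geq r - 1$ such that $d(p^j \cdot x) = p^{j-r+1}\cdot d(x)$ for all $x \in M$. If $q - 1$ does not divide $r - 1$, then $d = 0$. -/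
/-- The ideal `(q) ⊆ ℤ` is prime when `q` is a prime number. -/
instance span_q_isPrime (q : ℕ) [hq : Fact q.Prime] :
    (Ideal.span {(q : ℤ)}).IsPrime :=
  (Ideal.span_singleton_prime (by exact_mod_cast hq.out.ne_zero)).mpr
    ((Nat.prime_iff_prime_int.mp hq.out))

/-- `ℤ_(q)`, the localization of `ℤ` at the prime ideal `(q)`. -/
abbrev ZLoc (q : ℕ) [Fact q.Prime] : Type :=
  Localization.AtPrime (Ideal.span {(q : ℤ)})

/-- An integer not divisible by `q` is a unit in `ℤ_(q)`. -/
theorem isUnit_intCast_zLoc (q : ℕ) [Fact q.Prime] {n : ℤ} (hn : ¬ (q : ℤ) ∣ n) :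
    IsUnit (n : ZLoc q) := by
  have h : n ∈ (Ideal.span {(q : ℤ)}).primeCompl := fun h ↦
    hn (Ideal.mem_span_singleton.mp h)
  simpa using IsLocalization.map_units (ZLoc q) ⟨n, h⟩

/-- A power of a generator of `(ℤ/qℤ)ˣ` is congruent to `1` only if `q - 1` divides the exponent. -/
theorem sub_one_dvd_of_dvd_pow_sub_one (q : ℕ) [Fact q.Prime] {p : ℕ}
    {u : (ZMod q)ˣ} (hu : (u : ZMod q) = (p : ZMod q)) (hgen : Subgroup.zpowers u = ⊤)
    {k : ℕ} (h : (q : ℤ) ∣ (p : ℤ) ^ k - 1) : q - 1 ∣ k := by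
  rw [← ZMod.card_units q, ← Nat.card_eq_fintype_card,
    ← orderOf_eq_card_of_zpowers_eq_top hgen, orderOf_dvd_iff_pow_eq_one, Units.ext_iff]
  rw [← ZMod.intCast_zmod_eq_zero_iff_dvd] at h
  push_cast at h ⊢
  rw [hu]
  exact sub_eq_zero.mp h

/-- Let `q` be a prime, `M N` modules over `ℤ_(q)` and `d : M →ₗ N`.  Let `p` be a
prime distinct from `q` whose residue class generates `(ℤ/qℤ)ˣ`, and `j r`
integers with `r ≥ 2` and `j ≥ r - 1` such that `d (p ^ j • x) = p ^ (j - r + 1) • d x`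
for all `x`.  If `q - 1` does not divide `r - 1`, then `d = 0`. -/
theorem differential_eq_zero (q : ℕ) [Fact q.Prime]
    (M N : Type) [AddCommGroup M] [AddCommGroup N]
    [Module (ZLoc q) M] [Module (ZLoc q) N]
    (d : M →ₗ[ZLoc q] N)
    (p : ℕ) (hp : p.Prime) (hpq : p ≠ q)
    (u : (ZMod q)ˣ) (hu : (u : ZMod q) = (p : ZMod q))
    (hgen : Subgroup.zpowers u = ⊤)
    (j r : ℕ) (hr : 2 ≤ r) (hj : r - 1 ≤ j)
    (hd : ∀ x : M, d ((p : ℤ) ^ j • x) = (p : ℤ) ^ (j + 1 - r) • d x)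
    (hnd : ¬ (q - 1) ∣ (r - 1)) :
    d = 0 := by
  have hq : q.Prime := Fact.out
  have hpunit : ¬ (q : ℤ) ∣ (p : ℤ) ^ (j + 1 - r) := fun h ↦
    hpq ((Nat.prime_dvd_prime_iff_eq hq hp).mp
      (hq.dvd_of_dvd_pow (by exact_mod_cast h))).symm
  have hunit : ¬ (q : ℤ) ∣ (p : ℤ) ^ (j + 1 - r) * ((p : ℤ) ^ (r - 1) - 1) := fun h ↦
    ((Nat.prime_iff_prime_int.mp hq).dvd_or_dvd h).elim hpunit
      fun h ↦ hnd (sub_one_dvd_of_dvd_pow_sub_one q hu hgen h)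
  ext x
  rw [LinearMap.zero_apply, ← (isUnit_intCast_zLoc q hunit).smul_eq_zero, Int.cast_smul_eq_zsmul,
    mul_sub, ← pow_add, mul_one, show j + 1 - r + (r - 1) = j by omega, sub_smul, ← map_zsmul,
    hd, sub_self]
end
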